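/- arXiv:2604.16867 — 2 statements merged into one kernel-verified Lean document; each statement's English description precedes it below -/
import Mathlib

section
/- Let p ≥ 5 be a prime, let b, ε be integers with 0 ≤ b ≤ p − 2 and 0 ≤ ε ≤ p − 1, set n = bp + ε, and let m ≥ 1 be an integer. Define the rational number A = C((b+1)p − 1, n)·(−1)^n·(−1)^{b+1}·[ (b+1)!·{m brace b+1} + p·H_ε·(b+1)!·{m+1 brace b+1} − (b+1)^m − p·H_ε·(b+1)^{m+1} ] − (b+1)^m. Then A ≡ −(b+1)!·{m brace b+1} − p·H_ε·(b+1)!·{m brace b} mod p². -/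
/-- Congruence of rational numbers modulo `p^k`. -/
def RatCong (p k : ℕ) (x y : ℚ) : Prop :=
  x = y ∨ (k : ℤ) ≤ padicValRat p (x - y)

/-- Stirling number of the second kind `{t brace s}` (with the convention `0^0 = 1`),
viewed as a rational number. -/
def stir (t s : ℕ) : ℚ :=
  (1 / (Nat.factorial s : ℚ)) *
    ∑ j ∈ Finset.range (s + 1), (-1 : ℚ) ^ j * (s.choose j : ℚ) * ((s - j : ℕ) : ℚ) ^ t

/-- The rational number `A` of the statement, with `n = b·p + ε`. -/
def Aexpr (p b ε m : ℕ) : ℚ :=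
  ((((b + 1) * p - 1).choose (b * p + ε) : ℚ)) * (-1 : ℚ) ^ (b * p + ε) * (-1 : ℚ) ^ (b + 1) *
      (((b + 1).factorial : ℚ) * stir m (b + 1) +
        (p : ℚ) * harmonic ε * ((b + 1).factorial : ℚ) * stir (m + 1) (b + 1) -
        ((b : ℚ) + 1) ^ m - (p : ℚ) * harmonic ε * ((b : ℚ) + 1) ^ (m + 1)) -
    ((b : ℚ) + 1) ^ m

/-- `x` is `p^k` times a `p`-integral rational. -/
def DD (p k : ℕ) (x : ℚ) : Prop :=
  ∃ a d : ℤ, ¬ ((p : ℤ) ∣ d) ∧ x * d = (p : ℚ) ^ k * a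

theorem DD.add {p k : ℕ} (hp : p.Prime) {x y : ℚ} (hx : DD p k x) (hy : DD p k y) :
    DD p k (x + y) := by
  obtain ⟨a, d, hd, h⟩ := hx
  obtain ⟨a', d', hd', h'⟩ := hy
  refine ⟨a * d' + a' * d, d * d', ?_, ?_⟩
  · intro hh
    rcases (Nat.prime_iff_prime_int.mp hp).dvd_or_dvd hh with h1 | h1
    · exact hd h1
    · exact hd' h1
  · push_cast
    linear_combination (d' : ℚ) * h + (d : ℚ) * h'

theorem DD.mul {p j k : ℕ} (hp : p.Prime) {x y : ℚ} (hx : DD p j x) (hy : DD p k y) :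
    DD p (j + k) (x * y) := by
  obtain ⟨a, d, hd, h⟩ := hx
  obtain ⟨a', d', hd', h'⟩ := hy
  refine ⟨a * a', d * d', ?_, ?_⟩
  · intro hh
    rcases (Nat.prime_iff_prime_int.mp hp).dvd_or_dvd hh with h1 | h1
    · exact hd h1
    · exact hd' h1
  · push_cast
    rw [pow_add]
    linear_combination (y * d' : ℚ) * h + ((p : ℚ) ^ j * a) * h'

theorem DD.int {p : ℕ} (hp : p.Prime) (z : ℤ) : DD p 0 (z : ℚ) := by
  refine ⟨z, 1, ?_, by simp⟩
  intro h
  exact (Nat.prime_iff_prime_int.mp hp).not_isUnit (isUnit_of_dvd_one h)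

theorem DD.nat {p : ℕ} (hp : p.Prime) (z : ℕ) : DD p 0 (z : ℚ) := by
  exact_mod_cast DD.int hp z

theorem DD.self {p : ℕ} (hp : p.Prime) : DD p 1 (p : ℚ) := by
  refine ⟨1, 1, ?_, by simp⟩
  intro h
  exact (Nat.prime_iff_prime_int.mp hp).not_isUnit (isUnit_of_dvd_one h)

theorem DD.zero {p : ℕ} (hp : p.Prime) (k : ℕ) : DD p k 0 := by
  refine ⟨0, 1, ?_, by simp⟩
  intro h
  exact (Nat.prime_iff_prime_int.mp hp).not_isUnit (isUnit_of_dvd_one h)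

theorem DD.neg {p k : ℕ} {x : ℚ} (hx : DD p k x) : DD p k (-x) := by
  obtain ⟨a, d, hd, h⟩ := hx
  exact ⟨-a, d, hd, by push_cast; linear_combination -h⟩

theorem DD.sub {p k : ℕ} (hp : p.Prime) {x y : ℚ} (hx : DD p k x) (hy : DD p k y) :
    DD p k (x - y) := by
  rw [sub_eq_add_neg]
  exact hx.add hp hy.neg

theorem DD.inv {p i : ℕ} (h0 : 0 < i) (hi : i < p) : DD p 0 ((i : ℚ)⁻¹) := by
  refine ⟨1, i, ?_, ?_⟩
  · intro h
    have := Nat.le_of_dvd h0 (by exact_mod_cast h)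
    omega
  · have : (i : ℚ) ≠ 0 := by positivity
    push_cast
    field_simp

theorem DD.weaken {p k : ℕ} {x : ℚ} (hx : DD p (k + 1) x) : DD p k x := by
  obtain ⟨a, d, hd, h⟩ := hx
  exact ⟨p * a, d, hd, by push_cast; rw [h, pow_succ]; ring⟩

theorem DD.ratCong {p k : ℕ} (hp : p.Prime) {x y : ℚ} (h : DD p k (x - y)) : RatCong p k x y := by
  haveI := Fact.mk hp
  obtain ⟨a, d, hd, h⟩ := h
  by_cases hxy : x = y
  · exact Or.inl hxy
  right
  have hz : x - y ≠ 0 := sub_ne_zero.mpr hxy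
  have hd0 : (d : ℚ) ≠ 0 := by
    intro h0
    apply hd
    have : d = 0 := by exact_mod_cast h0
    simp [this]
  have hp0 : (p : ℚ) ≠ 0 := by exact_mod_cast hp.ne_zero
  have ha : (a : ℚ) ≠ 0 := by
    intro h0
    rw [h0, mul_zero] at h
    exact (mul_ne_zero hz hd0) h
  have hv := congrArg (padicValRat p) h
  rw [padicValRat.mul hz hd0, padicValRat.mul (pow_ne_zero _ hp0) ha, padicValRat.pow,
    padicValRat.self hp.one_lt, padicValRat.of_int, padicValRat.of_int,
    padicValInt.eq_zero_of_not_dvd hd] at hv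
  simp at hv
  rw [hv]
  simp

theorem DD.harmonic {p : ℕ} (hp : p.Prime) (k : ℕ) (hk : k < p) : DD p 0 (harmonic k) := by
  induction k with
  | zero => simpa using DD.zero hp 0
  | succ k ih =>
    rw [harmonic_succ]
    exact (ih (by omega)).add hp (DD.inv (by omega) hk)

theorem harm_aux {p : ℕ} (hp : p.Prime) (e : ℕ) (he : e ≤ p - 1) :
    DD p 1 ((_root_.harmonic (p - 1 - e) - _root_.harmonic e) - _root_.harmonic (p - 1)) := by
  induction e with
  | zero => simpa using DD.zero hp 1
  | succ e ih =>
    have ih := ih (by omega)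
    obtain ⟨r, hr⟩ : ∃ r, p - 1 - e = r + 1 := ⟨p - 1 - e - 1, by omega⟩
    have hr' : p - 1 - (e + 1) = r := by omega
    rw [hr, harmonic_succ] at ih
    rw [hr', harmonic_succ]
    have h1 : DD p 0 (((r + 1 : ℕ) : ℚ)⁻¹) := DD.inv (by omega) (by omega)
    have h2 : DD p 0 (((e + 1 : ℕ) : ℚ)⁻¹) := DD.inv (by omega) (by omega)
    have h3 := (DD.self hp).mul hp (h1.mul hp h2)
    have := ih.sub hp h3
    convert this using 1
    have hpp : (p : ℚ) = ((r + 1 : ℕ) : ℚ) + ((e + 1 : ℕ) : ℚ) := by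
      have : p = (r + 1) + (e + 1) := by omega
      exact_mod_cast this
    rw [hpp]
    have a1 : ((r + 1 : ℕ) : ℚ) ≠ 0 := by positivity
    have a2 : ((e + 1 : ℕ) : ℚ) ≠ 0 := by positivity
    field_simp
    ring

theorem harm_refl {p : ℕ} (hp : p.Prime) (hp5 : 5 ≤ p) (e : ℕ) (he : e ≤ p - 1) :
    DD p 1 (_root_.harmonic (p - 1 - e) - _root_.harmonic e) := by
  have hodd : p % 2 = 1 := by
    rcases hp.eq_two_or_odd with h | h <;> omega
  have h0 := harm_aux hp ((p - 1) / 2) (by omega)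
  rw [show p - 1 - (p - 1) / 2 = (p - 1) / 2 by omega] at h0
  have := (harm_aux hp e he).sub hp h0
  convert this using 1
  ring

theorem choose_aux {p : ℕ} (hp : p.Prime) (a k : ℕ) (ha : 1 ≤ a) (hk : k < p) :
    DD p 2 (((a * p - 1).choose k : ℚ) - (-1) ^ k * (1 - a * p * _root_.harmonic k)) := by
  induction k with
  | zero => simpa using DD.zero hp 2
  | succ k ih =>
    have ih := ih (by omega)
    have hle : p ≤ a * p := Nat.le_mul_of_pos_left p ha
    have hc := Nat.choose_succ_right_eq (a * p - 1) k
    have hc' : (((a * p - 1).choose (k + 1) : ℕ) : ℚ) * ((k + 1 : ℕ) : ℚ)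
        = ((a * p - 1).choose k : ℚ) * ((a : ℚ) * p - ((k + 1 : ℕ) : ℚ)) := by
      have h1 : ((a * p - 1 - k : ℕ) : ℚ) = (a : ℚ) * p - ((k + 1 : ℕ) : ℚ) := by
        rw [show a * p - 1 - k = a * p - (k + 1) by omega, Nat.cast_sub (by omega)]
        push_cast
        ring
      rw [← h1]
      exact_mod_cast hc
    have hi : DD p 0 (((k + 1 : ℕ) : ℚ)⁻¹) := DD.inv (by omega) hk
    have hH := DD.harmonic hp k (by omega)
    have hap := (DD.nat hp a).mul hp (DD.self hp)
    have hs : DD p 0 ((-1 : ℚ) ^ (k + 1)) := by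
      have := DD.int hp ((-1) ^ (k + 1))
      push_cast at this
      exact this
    have t1 := hs.mul hp ((hap.mul hp hap).mul hp (hH.mul hp hi))
    have h1 : DD p 0 (1 : ℚ) := by simpa using DD.nat hp 1
    have t2 := ih.mul hp (h1.sub hp (DD.weaken (hap.mul hp hi)))
    have := t1.sub hp t2
    convert this using 1
    rw [harmonic_succ]
    have a1 : ((k + 1 : ℕ) : ℚ) ≠ 0 := by positivity
    have hc2 : (((a * p - 1).choose (k + 1) : ℕ) : ℚ)
        = ((a * p - 1).choose k : ℚ) * ((a : ℚ) * p * ((k + 1 : ℕ) : ℚ)⁻¹ - 1) := by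
      field_simp
      linear_combination hc'
    rw [hc2, pow_succ]
    ring

/-- `s! {t brace s}`. -/
def SS (t s : ℕ) : ℤ :=
  ∑ j ∈ Finset.range (s + 1), (-1 : ℤ) ^ j * (s.choose j : ℤ) * ((s - j : ℕ) : ℤ) ^ t

theorem stir_SS (t s : ℕ) : (s.factorial : ℚ) * stir t s = (SS t s : ℚ) := by
  have : (s.factorial : ℚ) ≠ 0 := by exact_mod_cast s.factorial_ne_zero
  unfold stir SS
  push_cast
  field_simp

theorem SS_rec (m b : ℕ) : SS (m + 1) (b + 1) - (b + 1) * SS m (b + 1) = (b + 1) * SS m b := by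
  unfold SS
  rw [Finset.mul_sum, Finset.mul_sum, ← Finset.sum_sub_distrib, Finset.sum_range_succ']
  simp only [Nat.sub_zero, Nat.choose_zero_right, pow_zero]
  rw [show ∀ x y z w : ℤ, w = 0 → x = y → x + w = y from fun x y z w h h' => by rw [h, h', add_zero]]
  · exact 0
  · push_cast
    ring
  · apply Finset.sum_congr rfl
    intro j hj
    have hj' : j ≤ b := by simpa [Nat.lt_succ_iff] using hj
    have h := Nat.add_one_mul_choose_eq b j
    have h' : ((b : ℤ) + 1) * (b.choose j) = ((b + 1).choose (j + 1)) * (j + 1) := by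
      exact_mod_cast h
    rw [show b + 1 - (j + 1) = b - j by omega]
    have hx : ((b - j : ℕ) : ℤ) = b - j := by rw [Nat.cast_sub hj']
    rw [pow_succ (((b - j : ℕ) : ℤ)) m]
    generalize (((b - j : ℕ) : ℤ)) ^ m = X
    rw [hx, pow_succ]
    linear_combination -(-1) ^ j * X * h'

theorem star_j_mod_p_sq (p : ℕ) (hp : p.Prime) (hp5 : 5 ≤ p)
    (b ε m : ℕ) (hb : b ≤ p - 2) (hε : ε ≤ p - 1) (hm : 1 ≤ m) :
    RatCong p 2 (Aexpr p b ε m)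
      (-(((b + 1).factorial : ℚ)) * stir m (b + 1) -
        (p : ℚ) * harmonic ε * ((b + 1).factorial : ℚ) * stir m b) := by
  apply DD.ratCong hp
  have hodd : p % 2 = 1 := by
    rcases hp.eq_two_or_odd with h | h <;> omega
  have hap : (b + 1) * p = b * p + p := by ring
  have hsym : ((b + 1) * p - 1).choose (b * p + ε) = ((b + 1) * p - 1).choose (p - 1 - ε) := by
    rw [← Nat.choose_symm (n := (b + 1) * p - 1) (k := b * p + ε) (by omega)]
    congr 1
    omega
  have hC := choose_aux hp (b + 1) (p - 1 - ε) (by omega) (by omega)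
  rw [← hsym] at hC
  have hH := DD.harmonic hp ε (by omega)
  have hR := harm_refl hp hp5 ε hε
  have hsgn : ((-1 : ℚ)) ^ (p - 1 - ε) = (-1) ^ ε := by
    have : Even (p - 1 - ε + ε) := by
      rw [Nat.sub_add_cancel hε, Nat.even_iff]; omega
    have := Even.neg_one_pow (α := ℚ) this
    rw [pow_add] at this
    rcases neg_one_pow_eq_or ℚ ε with h | h <;> rw [h] at this ⊢ <;> linarith
  have hsgn2 : ((-1 : ℚ)) ^ (b * p + ε) * (-1) ^ (b + 1) = -(-1) ^ ε := by
    have : ((-1 : ℚ)) ^ p = -1 := Odd.neg_one_pow (Nat.odd_iff.mpr hodd)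
    rw [pow_add, mul_comm b p, pow_mul, this, pow_succ]
    have : ((-1 : ℚ)) ^ b * (-1) ^ b = 1 := by rw [← mul_pow]; simp
    linear_combination (-(-1 : ℚ) ^ ε) * this
  rw [hsgn] at hC
  have hs : ((-1 : ℚ)) ^ ε * (-1) ^ ε = 1 := by rw [← mul_pow]; simp
  have hs0 : DD p 0 ((-1 : ℚ) ^ ε) := by
    have := DD.int hp ((-1) ^ ε)
    push_cast at this
    exact this
  have hrec : (SS (m + 1) (b + 1) : ℚ) - (b + 1) * SS m (b + 1) = (b + 1) * SS m b := by
    exact_mod_cast SS_rec m b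
  have e1 := stir_SS m (b + 1)
  have e2 := stir_SS (m + 1) (b + 1)
  have e3 := stir_SS m b
  unfold Aexpr
  generalize (((b + 1) * p - 1).choose (b * p + ε) : ℚ) = C at hC ⊢
  generalize harmonic (p - 1 - ε) = H' at hC hR
  generalize harmonic ε = H at hR hH ⊢
  have e3' : ((b + 1).factorial : ℚ) * stir m b = (b + 1) * SS m b := by
    rw [Nat.factorial_succ]; push_cast; linear_combination ((b : ℚ) + 1) * e3
  generalize ((b + 1).factorial : ℚ) = F at *
  generalize ((-1 : ℚ) ^ ε) = s at *
  have hpp := DD.self hp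
  have hb1 : DD p 0 ((b : ℚ) + 1) := by exact_mod_cast DD.nat hp (b + 1)
  have hbm : DD p 0 (((b : ℚ) + 1) ^ m) := by exact_mod_cast DD.nat hp ((b + 1) ^ m)
  have hbm1 : DD p 0 (((b : ℚ) + 1) ^ (m + 1)) := by exact_mod_cast DD.nat hp ((b + 1) ^ (m + 1))
  have hS1 := DD.int hp (SS m (b + 1))
  have hS2 := DD.int hp (SS (m + 1) (b + 1))
  push_cast at hC
  -- C = s (1 - (b+1) p H) + E with E ∈ p²
  have hE : DD p 2 (C - s * (1 - ((b : ℚ) + 1) * p * H)) := by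
    have t := hC.sub hp (hs0.mul hp (hb1.mul hp (hpp.mul hp hR)))
    convert t using 1
    ring
  have hY := hS2.sub hp hbm1
  have hX := (hS1.sub hp hbm).add hp (DD.weaken (hpp.mul hp (hH.mul hp hY)))
  have t1 := hE.mul hp (hs0.mul hp hX)
  have t2 := (hpp.mul hp hpp).mul hp (hb1.mul hp ((hH.mul hp hH).mul hp hY))
  have := t2.sub hp t1
  convert this using 1
  have g1 : F * stir m (b + 1) + (p : ℚ) * H * F * stir (m + 1) (b + 1) - ((b : ℚ) + 1) ^ m
      - (p : ℚ) * H * ((b : ℚ) + 1) ^ (m + 1)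
      = (SS m (b + 1) - ((b : ℚ) + 1) ^ m)
        + p * (H * (SS (m + 1) (b + 1) - ((b : ℚ) + 1) ^ (m + 1))) := by
    linear_combination e1 + p * H * e2
  have g2 : -F * stir m (b + 1) - p * H * F * stir m b
      = -SS m (b + 1) - p * H * (SS (m + 1) (b + 1) - (b + 1) * SS m (b + 1)) := by
    linear_combination -e1 - p * H * e3' + p * H * hrec
  rw [g1, g2, mul_assoc C, hsgn2]
  rw [pow_succ]
  generalize ((b : ℚ) + 1) ^ m = B
  linear_combination (-(1 - ((b : ℚ) + 1) * p * H) * ((SS m (b + 1) - B)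
        + p * (H * (SS (m + 1) (b + 1) - B * ((b : ℚ) + 1))))) * hs
end

section
/- Let p ≥ 5 be a prime, let b, ε be integers with 0 ≤ b ≤ p − 2 and 0 ≤ ε ≤ p − 1, set n = bp + ε, and let m ≥ 1 be an integer. Define the rational number A = C((b+1)p − 1, n)·(−1)^n·(−1)^{b+1}·[ (b+1)!·{m brace b+1} + p·H_ε·(b+1)!·{m+1 brace b+1} − (b+1)^m − p·H_ε·(b+1)^{m+1} ] − (b+1)^m. Then: (a) if 1 ≤ m ≤ b − 1 then A ≡ 0 mod p²; (b) if m = b (with b ≥ 1) then A ≡ −p·H_ε·(b+1)! mod p²; (c) if m = b + 1 then A ≡ −(b+1)! − p·H_ε·(b+1)!·C(b+1, 2) mod p². -/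
/-- The ring of `p`-integral rationals. -/
def pIntRing (p : ℕ) [Fact p.Prime] : Subring ℚ where
  carrier := {x | padicNorm p x ≤ 1}
  mul_mem' := by
    intro a b ha hb
    simp only [Set.mem_ofPred_eq] at *
    rw [padicNorm.mul]
    exact mul_le_one₀ ha (padicNorm.nonneg _) hb
  one_mem' := by simp
  add_mem' := by
    intro a b ha hb
    simp only [Set.mem_ofPred_eq] at *
    exact padicNorm.nonarchimedean.trans (max_le ha hb)
  zero_mem' := by simp
  neg_mem' := by
    intro a ha
    simpa using ha

theorem inv_mem_pIntRing (p : ℕ) [Fact p.Prime] (k : ℕ) (h0 : 0 < k) (hk : k < p) :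
    ((k : ℚ))⁻¹ ∈ pIntRing p := by
  have h : padicNorm p (k : ℚ) = 1 := by
    have := (padicNorm.int_eq_one_iff (p := p) (k : ℤ)).2 (by
      intro hd
      have : p ∣ k := by exact_mod_cast hd
      exact absurd (Nat.le_of_dvd h0 this) (by omega))
    simpa using this
  change padicNorm p ((k : ℚ)⁻¹) ≤ 1
  rw [← one_div, padicNorm.div, h]
  simp

theorem harmonic_mem_pIntRing (p : ℕ) [Fact p.Prime] (k : ℕ) (hk : k < p) :
    harmonic k ∈ pIntRing p := by
  induction k with
  | zero => simpa using (pIntRing p).zero_mem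
  | succ k ih =>
    rw [harmonic_succ]
    exact (pIntRing p).add_mem (ih (by omega)) (inv_mem_pIntRing p (k + 1) (by omega) hk)

theorem ratCong_of_mem (p : ℕ) [hp : Fact p.Prime] (x y z : ℚ) (hz : z ∈ pIntRing p)
    (h : x - y = (p : ℚ) ^ 2 * z) : RatCong p 2 x y := by
  by_cases hxy : x = y
  · exact Or.inl hxy
  right
  have hz' : padicNorm p z ≤ 1 := hz
  have hp0 : (p : ℚ) ≠ 0 := by exact_mod_cast hp.1.ne_zero
  have hz0 : z ≠ 0 := by
    rintro rfl
    exact hxy (by linarith)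
  have hp1 : (1 : ℚ) < p := by exact_mod_cast hp.1.one_lt
  rw [padicNorm.eq_zpow_of_nonzero hz0, zpow_le_one_iff_right₀ hp1] at hz'
  rw [h, padicValRat.mul (pow_ne_zero _ hp0) hz0, padicValRat.pow,
    padicValRat.self hp.1.one_lt]
  push_cast
  linarith

theorem choose_expand (p : ℕ) [hp : Fact p.Prime] (c : ℕ) (hc : 1 ≤ c) (k : ℕ) (hk : k < p) :
    ∃ z ∈ pIntRing p, (((c * p - 1).choose k : ℕ) : ℚ) * (-1) ^ k
      = 1 - c * p * harmonic k + (p : ℚ) ^ 2 * z := by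
  induction k with
  | zero => exact ⟨0, (pIntRing p).zero_mem, by simp⟩
  | succ k ih =>
    obtain ⟨z, hz, h⟩ := ih (by omega)
    have hi := inv_mem_pIntRing p (k + 1) (by omega) hk
    have hH := harmonic_mem_pIntRing p k (by omega)
    have hcp : k + 1 ≤ c * p := by nlinarith
    have hrec : (((c * p - 1).choose (k + 1) : ℕ) : ℚ) * ((k : ℚ) + 1)
        = ((c * p - 1).choose k : ℕ) * ((c : ℚ) * p - 1 - k) := by
      have := Nat.choose_succ_right_eq (c * p - 1) k
      have h2 : ((c * p - 1 - k : ℕ) : ℚ) = (c : ℚ) * p - 1 - k := by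
        rw [Nat.cast_sub (by omega), Nat.cast_sub (by omega)]
        push_cast
        ring
      rw [← h2]
      exact_mod_cast this
    have hk0 : (k : ℚ) + 1 ≠ 0 := by positivity
    have hrec2 : (((c * p - 1).choose (k + 1) : ℕ) : ℚ) * (-1) ^ (k + 1)
        = (((c * p - 1).choose k : ℕ) * (-1) ^ k) * (1 - c * p * (((k + 1 : ℕ) : ℚ))⁻¹) := by
      have : (((c * p - 1).choose (k + 1) : ℕ) : ℚ)
          = ((c * p - 1).choose k : ℕ) * ((c : ℚ) * p - 1 - k) / ((k : ℚ) + 1) := by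
        rw [← hrec]; field_simp
      rw [this, pow_succ]
      push_cast
      field_simp
      ring
    have hcR : (c : ℚ) ∈ pIntRing p := natCast_mem _ c
    have hpR : (p : ℚ) ∈ pIntRing p := natCast_mem _ p
    refine ⟨z * (1 - c * p * (((k + 1 : ℕ) : ℚ))⁻¹)
      + c * c * harmonic k * (((k + 1 : ℕ) : ℚ))⁻¹, ?_, ?_⟩
    · exact add_mem (mul_mem hz (sub_mem (one_mem _) (mul_mem (mul_mem hcR hpR) hi)))
        (mul_mem (mul_mem (mul_mem hcR hcR) hH) hi)
    · rw [hrec2, h, harmonic_succ]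
      ring

theorem harmonic_symm (p : ℕ) [hp : Fact p.Prime] (ho : Odd p) (k : ℕ) (hk : k < p) :
    ∃ z ∈ pIntRing p, (p : ℚ) * harmonic (p - 1 - k) = p * harmonic k + (p : ℚ) ^ 2 * z := by
  obtain ⟨z, hz, h⟩ := choose_expand p 1 le_rfl k hk
  obtain ⟨w, hw, h'⟩ := choose_expand p 1 le_rfl (p - 1 - k) (by omega)
  have hs : ((-1 : ℚ)) ^ (p - 1 - k) = (-1) ^ k := by
    rw [neg_one_pow_eq_pow_mod_two, neg_one_pow_eq_pow_mod_two (n := k)]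
    congr 1
    obtain ⟨r, hr⟩ := ho
    omega
  rw [one_mul, Nat.choose_symm (by omega), hs] at h'
  rw [one_mul, h'] at h
  refine ⟨w - z, sub_mem hw hz, ?_⟩
  push_cast at h
  linear_combination -h

theorem choose_main (p : ℕ) [hp : Fact p.Prime] (ho : Odd p) (b e : ℕ) (he : e < p) :
    ∃ z ∈ pIntRing p, ((((b + 1) * p - 1).choose (b * p + e) : ℕ) : ℚ) * (-1 : ℚ) ^ (b * p + e)
      * (-1 : ℚ) ^ (b + 1) = -(1 - ((b : ℚ) + 1) * p * harmonic e) + (p : ℚ) ^ 2 * z := by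
  obtain ⟨z, hz, h⟩ := choose_expand p (b + 1) (by omega) (p - 1 - e) (by omega)
  obtain ⟨w, hw, h'⟩ := harmonic_symm p ho e he
  have hadd : (b + 1) * p = b * p + p := by ring
  have hsy : ((b + 1) * p - 1).choose (b * p + e) = ((b + 1) * p - 1).choose (p - 1 - e) := by
    apply Nat.choose_symm_of_eq_add
    omega
  have hs : (-1 : ℚ) ^ (b * p + e) * (-1 : ℚ) ^ (b + 1) = -(-1) ^ (p - 1 - e) := by
    obtain ⟨r, hr⟩ := ho
    have : (-1 : ℚ) ^ (b * p + e) * (-1 : ℚ) ^ (b + 1) = (-1) ^ (p - 1 - e + 1) := by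
      rw [← pow_add, neg_one_pow_eq_pow_mod_two, neg_one_pow_eq_pow_mod_two (n := p - 1 - e + 1)]
      congr 1
      have : b * p = 2 * (b * r) + b := by rw [hr]; ring
      omega
    rw [this, pow_succ]; ring
  have hbR : (b : ℚ) ∈ pIntRing p := natCast_mem _ b
  refine ⟨(b + 1) * w - z, sub_mem (mul_mem (add_mem hbR (one_mem _)) hw) hz, ?_⟩
  rw [mul_assoc, hs, hsy]
  push_cast at h
  linear_combination -h + ((b : ℚ) + 1) * h'

/-- The alternating sum that equals `s! * {t brace s}`. -/
def altSum (t s : ℕ) : ℚ :=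
  ∑ j ∈ Finset.range (s + 1), (-1 : ℚ) ^ j * (s.choose j : ℚ) * ((s - j : ℕ) : ℚ) ^ t

theorem altSum_rec (t s : ℕ) :
    altSum (t + 1) (s + 1) = (s + 1) * (altSum t s + altSum t (s + 1)) := by
  have h1 : altSum (t + 1) (s + 1) = (s + 1) * ∑ j ∈ Finset.range (s + 1),
      (-1 : ℚ) ^ j * (s.choose j : ℚ) * ((s + 1 - j : ℕ) : ℚ) ^ t := by
    unfold altSum
    rw [Finset.sum_range_succ, Finset.mul_sum]
    simp only [Nat.sub_self, Nat.cast_zero, ne_eq, Nat.add_eq_zero_iff, one_ne_zero, and_false,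
      not_false_eq_true, zero_pow, mul_zero, add_zero]
    refine Finset.sum_congr rfl fun j hj => ?_
    have h := Nat.choose_mul_succ_eq s j
    have h' : (s.choose j : ℚ) * (s + 1) = ((s + 1).choose j : ℚ) * ((s + 1 - j : ℕ) : ℚ) := by
      exact_mod_cast h
    rw [pow_succ]
    linear_combination -((-1 : ℚ) ^ j * ((s + 1 - j : ℕ) : ℚ) ^ t) * h'
  have h2 : altSum t (s + 1) = (∑ j ∈ Finset.range (s + 1),
      (-1 : ℚ) ^ j * (s.choose j : ℚ) * ((s + 1 - j : ℕ) : ℚ) ^ t) - altSum t s := by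
    unfold altSum
    rw [Finset.sum_range_succ' _ (s + 1)]
    have h3 : ∑ j ∈ Finset.range (s + 1),
        (-1 : ℚ) ^ j * (s.choose j : ℚ) * ((s + 1 - j : ℕ) : ℚ) ^ t
        = ∑ j ∈ Finset.range (s + 1),
          (-1 : ℚ) ^ (j + 1) * (s.choose (j + 1) : ℚ) * ((s - j : ℕ) : ℚ) ^ t
          + ((s + 1 : ℕ) : ℚ) ^ t := by
      have h4 := Finset.sum_range_succ' (fun j =>
        (-1 : ℚ) ^ j * (s.choose j : ℚ) * ((s + 1 - j : ℕ) : ℚ) ^ t) (s + 1)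
      rw [Finset.sum_range_succ] at h4
      simpa using h4
    rw [h3, add_sub_right_comm, ← Finset.sum_sub_distrib]
    congr 1
    · refine Finset.sum_congr rfl fun j hj => ?_
      rw [Nat.choose_succ_succ, Nat.add_sub_add_right]
      push_cast
      ring
    · simp
  rw [h1, h2]
  ring

theorem altSum_eq (t s : ℕ) : altSum t s = (s.factorial : ℚ) * (Nat.stirlingSecond t s : ℚ) := by
  induction t generalizing s with
  | zero =>
    have h := Int.alternating_sum_range_choose (n := s)
    have h' : altSum 0 s = ((∑ j ∈ Finset.range (s + 1), (-1 : ℤ) ^ j * (s.choose j : ℤ) : ℤ) : ℚ) := by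
      unfold altSum
      push_cast
      simp
    rw [h', h]
    cases s <;> simp
  | succ t ih =>
    cases s with
    | zero => simp [altSum]
    | succ s =>
      rw [altSum_rec, ih, ih, Nat.stirlingSecond_succ_succ, Nat.factorial_succ]
      push_cast
      ring

theorem stir_eq (t s : ℕ) : stir t s = (Nat.stirlingSecond t s : ℚ) := by
  have h : stir t s = 1 / (s.factorial : ℚ) * altSum t s := rfl
  have h0 : (s.factorial : ℚ) ≠ 0 := by exact_mod_cast s.factorial_ne_zero
  rw [h, altSum_eq]
  field_simp

theorem Aexpr_expand (p : ℕ) [hp : Fact p.Prime] (ho : Odd p) (b e m : ℕ) (he : e < p) :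
    ∃ z ∈ pIntRing p, Aexpr p b e m =
      -((1 - ((b : ℚ) + 1) * p * harmonic e) * (((b + 1).factorial : ℚ) *
        ((Nat.stirlingSecond m (b + 1) : ℚ) + p * harmonic e * Nat.stirlingSecond (m + 1) (b + 1))))
      + (p : ℚ) ^ 2 * z := by
  obtain ⟨z, hz, h⟩ := choose_main p ho b e he
  have hH := harmonic_mem_pIntRing p e he
  have hn : ∀ n : ℕ, (n : ℚ) ∈ pIntRing p := fun n => natCast_mem _ n
  have hc : ((b : ℚ) + 1) ∈ pIntRing p := add_mem (hn b) (one_mem _)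
  refine ⟨z * (((b + 1).factorial : ℚ) * Nat.stirlingSecond m (b + 1) +
        (p : ℚ) * harmonic e * ((b + 1).factorial : ℚ) * Nat.stirlingSecond (m + 1) (b + 1) -
        ((b : ℚ) + 1) ^ m - (p : ℚ) * harmonic e * ((b : ℚ) + 1) ^ (m + 1))
        - ((b : ℚ) + 1) ^ (m + 2) * harmonic e ^ 2, ?_, ?_⟩
  · refine sub_mem (mul_mem hz (sub_mem (sub_mem (add_mem (mul_mem (hn _) (hn _))
      (mul_mem (mul_mem (mul_mem (hn _) hH) (hn _)) (hn _))) (pow_mem hc _))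
      (mul_mem (mul_mem (hn _) hH) (pow_mem hc _)))) (mul_mem (pow_mem hc _) (pow_mem hH _))
  · unfold Aexpr
    rw [h, stir_eq, stir_eq]
    ring

theorem star_j_values_mod_p_sq (p : ℕ) (hp : p.Prime) (hp5 : 5 ≤ p)
    (b ε m : ℕ) (hb : b ≤ p - 2) (hε : ε ≤ p - 1) (hm : 1 ≤ m) :
    -- (a) if 1 ≤ m ≤ b − 1 then A ≡ 0 mod p²
    (m ≤ b - 1 → RatCong p 2 (Aexpr p b ε m) 0) ∧
    -- (b) if m = b (with b ≥ 1) then A ≡ −p·H_ε·(b+1)! mod p²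
    (1 ≤ b → m = b →
      RatCong p 2 (Aexpr p b ε m)
        (-((p : ℚ) * harmonic ε * ((b + 1).factorial : ℚ)))) ∧
    -- (c) if m = b + 1 then A ≡ −(b+1)! − p·H_ε·(b+1)!·C(b+1, 2) mod p²
    (m = b + 1 →
      RatCong p 2 (Aexpr p b ε m)
        (-(((b + 1).factorial : ℚ)) -
          (p : ℚ) * harmonic ε * ((b + 1).factorial : ℚ) * ((b + 1).choose 2 : ℚ))) := by
  haveI : Fact p.Prime := ⟨hp⟩
  have ho : Odd p := hp.odd_of_ne_two (by omega)
  have he : ε < p := by omega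
  obtain ⟨z, hz, h⟩ := Aexpr_expand p ho b ε m he
  have hH := harmonic_mem_pIntRing p ε he
  have hn : ∀ n : ℕ, (n : ℚ) ∈ pIntRing p := fun n => natCast_mem _ n
  have hc : ((b : ℚ) + 1) ∈ pIntRing p := add_mem (hn b) (one_mem _)
  refine ⟨fun hmb => ?_, fun hb1 hmb => ?_, fun hmb => ?_⟩
  · rw [Nat.stirlingSecond_eq_zero_of_lt (by omega),
      Nat.stirlingSecond_eq_zero_of_lt (by omega)] at h
    refine ratCong_of_mem p _ _ z hz ?_
    rw [h]
    push_cast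
    ring
  · subst hmb
    rw [Nat.stirlingSecond_eq_zero_of_lt (by omega), Nat.stirlingSecond_self] at h
    refine ratCong_of_mem p _ _ (z + (m + 1) * harmonic ε ^ 2 * ((m + 1).factorial : ℚ))
      (add_mem hz (mul_mem (mul_mem hc (pow_mem hH _)) (hn _))) ?_
    rw [h]
    push_cast
    ring
  · subst hmb
    rw [Nat.stirlingSecond_succ_self_left, Nat.stirlingSecond_self,
      Nat.choose_succ_succ (b + 1) 1, Nat.choose_one_right] at h
    refine ratCong_of_mem p _ _ (z + (b + 1) * harmonic ε ^ 2 * ((b + 1).factorial : ℚ)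
      * ((b + 1 + (b + 1).choose 2 : ℕ) : ℚ))
      (add_mem hz (mul_mem (mul_mem (mul_mem hc (pow_mem hH _)) (hn _)) (hn _))) ?_
    rw [h]
    push_cast
    ring
end
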